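/- arXiv:1912.11758 — 2 statements merged into one kernel-verified Lean document; each statement's English description precedes it below -/
import Mathlib

section
/- There exists a binary self-dual code C ⊆ (ZMod 2)^{56} of dimension 28 whose minimum nonzero Hamming weight is 10, such that the number of codewords of Hamming weight 10 is 52 and the number of codewords of Hamming weight 12 is 4758 (i.e. C has weight enumerator W_{56,1} with α = −64). -/
/-- The dual of a linear code `C ⊆ Rⁿ` with respect to the form `∑ᵢ vᵢ wᵢ`. -/
def dualCode {R : Type*} [CommRing R] {ι : Type*} [Fintype ι]
    (C : Submodule R (ι → R)) : Submodule R (ι → R) where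
  carrier := {w | ∀ v ∈ C, ∑ i, v i * w i = 0}
  zero_mem' := by intro v _; simp
  add_mem' := by
    intro a b ha hb v hv
    have h1 := ha v hv
    have h2 := hb v hv
    simp only [Pi.add_apply, mul_add, Finset.sum_add_distrib, h1, h2, add_zero]
  smul_mem' := by
    intro c w hw v hv
    have h := hw v hv
    have : ∑ i, v i * (c • w) i = c * ∑ i, v i * w i := by
      rw [Finset.mul_sum]
      exact Finset.sum_congr rfl fun i _ => by
        simp [smul_eq_mul, mul_left_comm]
    simp only [Set.mem_setOf_eq] at *
    simpa [h] using this

open Matrix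

/-! ### Bit slices

A predicate on a list is stored as the binary number whose `i`-th digit is its value at the `i`-th
entry, so that pointwise operations on predicates become bitwise operations on numbers. -/

/-- The number whose `i`-th binary digit is the value of `f` at the `i`-th entry of `L`. -/
def bitSlice {α : Type*} (L : List α) (f : α → Bool) : ℕ :=
  L.foldr (fun a x => Nat.bit (f a) x) 0

section BitSlice

variable {α β : Type*} (L : List α) (f g : α → Bool)

@[simp] theorem bitSlice_nil : bitSlice [] f = 0 := rfl

@[simp] theorem bitSlice_cons (a : α) : bitSlice (a :: L) f = Nat.bit (f a) (bitSlice L f) := rfl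

theorem bitSlice_map (h : β → α) (M : List β) : bitSlice (M.map h) f = bitSlice M (f ∘ h) := by
  induction M with
  | nil => rfl
  | cons b M ih => simp [ih]

theorem bitSlice_xor : bitSlice L (fun a => f a ^^ g a) = bitSlice L f ^^^ bitSlice L g := by
  induction L with
  | nil => simp
  | cons a L ih => simp [ih, Nat.xor_bit]

theorem bitSlice_and : bitSlice L (fun a => f a && g a) = bitSlice L f &&& bitSlice L g := by
  induction L with
  | nil => simp
  | cons a L ih => simp [ih, Nat.land_bit]

theorem bitSlice_false : bitSlice L (fun _ => false) = 0 := by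
  induction L with
  | nil => rfl
  | cons a L ih => simp [ih]

theorem bitSlice_true : bitSlice L (fun _ => true) = 2 ^ L.length - 1 := by
  induction L with
  | nil => rfl
  | cons a L ih =>
    have := Nat.one_le_two_pow (n := L.length)
    simp only [bitSlice_cons, ih, Nat.bit_val, List.length_cons, pow_succ, Bool.toNat_true]
    omega

theorem bitSlice_not :
    bitSlice L (fun a => !f a) = bitSlice L f ^^^ bitSlice L (fun _ => true) := by
  simp [← bitSlice_xor]

theorem bitSlice_append (M : List α) :
    bitSlice (L ++ M) f = bitSlice L f + bitSlice M f <<< L.length := by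
  induction L with
  | nil => simp
  | cons a L ih =>
    simp only [List.cons_append, bitSlice_cons, ih, Nat.bit_val, List.length_cons,
      Nat.shiftLeft_eq, pow_succ]
    ring

theorem bitSlice_lt : bitSlice L f < 2 ^ L.length := by
  induction L with
  | nil => simp
  | cons a L ih =>
    have := Bool.toNat_lt (f a)
    simp only [bitSlice_cons, Nat.bit_val, List.length_cons, pow_succ]
    omega

end BitSlice

/-- The number of nonzero binary digits of `x`, for `x < 2 ^ 2 ^ d`. -/
def bitCount : ℕ → ℕ → ℕ
  | 0, x => x
  | d + 1, x => bif x == 0 then 0 else bitCount d (x / 2 ^ 2 ^ d) + bitCount d (x % 2 ^ 2 ^ d)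

theorem bitCount_zero_right (d : ℕ) : bitCount d 0 = 0 := by
  cases d <;> simp [bitCount]

theorem bitCount_bitSlice {α : Type*} (f : α → Bool) :
    ∀ (d : ℕ) (L : List α), L.length ≤ 2 ^ d → bitCount d (bitSlice L f) = L.countP f
  | 0, L, h => by
    match L, h with
    | [], _ => rfl
    | [a], _ => cases h : f a <;> simp [bitCount, h]
  | d + 1, L, h => by
    have key : bitCount d (bitSlice L f / 2 ^ 2 ^ d) + bitCount d (bitSlice L f % 2 ^ 2 ^ d)
        = L.countP f := by
      rcases le_total L.length (2 ^ d) with hL | hL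
      · have hlt := (bitSlice_lt L f).trans_le (Nat.pow_le_pow_right two_pos hL)
        rw [Nat.div_eq_of_lt hlt, Nat.mod_eq_of_lt hlt, bitCount_zero_right, zero_add,
          bitCount_bitSlice f d L hL]
      · have hlen : (L.take (2 ^ d)).length = 2 ^ d := by simpa using hL
        have hlt := bitSlice_lt (L.take (2 ^ d)) f
        have happ := bitSlice_append (L.take (2 ^ d)) f (L.drop (2 ^ d))
        rw [List.take_append_drop, hlen, Nat.shiftLeft_eq] at happ
        rw [hlen] at hlt
        rw [happ, Nat.add_mul_div_right _ _ (by positivity), Nat.add_mul_mod_self_right,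
          Nat.div_eq_of_lt hlt, Nat.mod_eq_of_lt hlt, zero_add,
          bitCount_bitSlice f d _ hlen.le,
          bitCount_bitSlice f d _ (by rw [List.length_drop]; rw [pow_succ] at h; omega),
          add_comm, ← List.countP_append, List.take_append_drop]
    by_cases h0 : bitSlice L f = 0
    · rw [h0, Nat.zero_div, Nat.zero_mod, bitCount_zero_right] at key
      rw [h0, bitCount_zero_right, ← key]
    · simpa [bitCount, beq_false_of_ne h0] using key

/-- `ps` lists the slices of the binary digits of the function `s`, least significant first. -/
def IsDigitSlices {α : Type*} (L : List α) : List ℕ → (α → ℕ) → Prop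
  | [], s => ∀ a, s a = 0
  | p :: ps, s => p = bitSlice L (fun a => (s a).testBit 0) ∧ IsDigitSlices L ps (fun a => s a / 2)

/-- Add a function with values in `{0, 1}` to a function given by its digit slices. -/
def addSlice : List ℕ → ℕ → List ℕ
  | [], c => [c]
  | p :: ps, c => (p ^^^ c) :: addSlice ps (p &&& c)

theorem IsDigitSlices.addSlice {α : Type*} {L : List α} {ps : List ℕ} {s : α → ℕ}
    (h : IsDigitSlices L ps s) (f : α → Bool) :
    IsDigitSlices L (addSlice ps (bitSlice L f)) (fun a => s a + (f a).toNat) := by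
  induction ps generalizing s f with
  | nil =>
    refine ⟨?_, fun a => ?_⟩
    · congr 1; funext a; cases hf : f a <;> simp [h a, hf]
    · cases hf : f a <;> simp [h a, hf]
  | cons p ps ih =>
    obtain ⟨hp, hs⟩ := h
    refine ⟨?_, ?_⟩
    · rw [hp, ← bitSlice_xor]
      congr 1; funext a
      rcases Nat.mod_two_eq_zero_or_one (s a) with h | h <;>
        cases hf : f a <;> simp [Nat.testBit_zero, h, hf, Nat.add_mod]
    · rw [hp, ← bitSlice_and]
      convert ih hs _ using 2 with a
      rcases Nat.mod_two_eq_zero_or_one (s a) with h | h <;>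
        cases hf : f a <;> simp [Nat.testBit_zero, h, hf] <;> omega

/-- The slice of the predicate `s = w`, where `ps` are the digit slices of `s` and `full` is the
slice of the predicate that is always true. -/
def eqSlice (full : ℕ) : List ℕ → ℕ → ℕ
  | [], w => bif w == 0 then full else 0
  | p :: ps, w => (bif w.testBit 0 then p else p ^^^ full) &&& eqSlice full ps (w / 2)

theorem IsDigitSlices.eqSlice {α : Type*} {L : List α} {ps : List ℕ} {s : α → ℕ}
    (h : IsDigitSlices L ps s) (w : ℕ) :
    eqSlice (2 ^ L.length - 1) ps w = bitSlice L (fun a => decide (s a = w)) := by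
  induction ps generalizing s w with
  | nil =>
    by_cases hw : w = 0
    · simp [_root_.eqSlice, hw, h _, bitSlice_true]
    · simp [_root_.eqSlice, beq_false_of_ne hw, h _, Ne.symm hw, bitSlice_false]
  | cons p ps ih =>
    obtain ⟨hp, hs⟩ := h
    have hd : (bif w.testBit 0 then p else p ^^^ (2 ^ L.length - 1))
        = bitSlice L (fun a => (s a).testBit 0 == w.testBit 0) := by
      cases w.testBit 0
      · simp [hp, ← bitSlice_true, ← bitSlice_not]
      · simp [hp]
    rw [_root_.eqSlice, hd, ih hs, ← bitSlice_and]
    congr 1; funext a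
    rw [Bool.eq_iff_iff]
    simp [Nat.testBit_zero]
    omega

/-! ### Enumerating the binary words of given weight -/

/-- The binary words of length `n` and weight `k`. -/
def wordsOfWeight : (n k : ℕ) → List (Fin n → ZMod 2)
  | 0, 0 => [![]]
  | 0, _ + 1 => []
  | n + 1, 0 => (wordsOfWeight n 0).map (vecCons 0)
  | n + 1, k + 1 =>
    (wordsOfWeight n (k + 1)).map (vecCons 0) ++ (wordsOfWeight n k).map (vecCons 1)

theorem hammingNorm_vecCons {n : ℕ} (c : ZMod 2) (u : Fin n → ZMod 2) :
    hammingNorm (vecCons c u) = (if c = 0 then 0 else 1) + hammingNorm u := by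
  simp only [hammingNorm, Fin.card_filter_univ_succ, cons_val_zero, cons_val_succ]
  split_ifs <;> simp_all [add_comm]

theorem mem_wordsOfWeight {n k : ℕ} {u : Fin n → ZMod 2} :
    u ∈ wordsOfWeight n k ↔ hammingNorm u = k := by
  induction n generalizing k with
  | zero =>
    have : hammingNorm u = 0 := by simp [hammingNorm]
    rw [this]
    cases k <;> simp [wordsOfWeight, Subsingleton.elim u ![]]
  | succ n ih =>
    obtain ⟨c, v, rfl⟩ : ∃ c v, u = vecCons c v := ⟨_, _, (cons_head_tail u).symm⟩
    have hc : c = 0 ∨ c = 1 := by revert c; decide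
    have inj (a b : ZMod 2) (x : Fin n → ZMod 2) : vecCons a x = vecCons b v ↔ x = v ∧ a = b := by
      rw [vecCons_inj, and_comm]
    rcases hc with rfl | rfl <;> cases k <;>
      simp [wordsOfWeight, hammingNorm_vecCons, inj, ih, add_comm 1, eq_comm (a := v)]

theorem nodup_wordsOfWeight (n k : ℕ) : (wordsOfWeight n k).Nodup := by
  induction n generalizing k with
  | zero => cases k <;> simp [wordsOfWeight]
  | succ n ih =>
    have inj (c : ZMod 2) : Function.Injective (vecCons c : (Fin n → ZMod 2) → _) :=
      fun _ _ h => (vecCons_inj.1 h).2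
    cases k with
    | zero => exact (ih 0).map (inj 0)
    | succ k =>
      refine ((ih _).map (inj 0)).append ((ih _).map (inj 1)) ?_
      rw [List.disjoint_left]
      simp only [List.mem_map]
      rintro _ ⟨x, -, rfl⟩ ⟨y, -, h⟩
      exact absurd (vecCons_inj.1 h).1 (by decide)

/-- The binary word of length `n` given by the binary digits of `c`. -/
def digitWord (n c : ℕ) : Fin n → ZMod 2 := fun i => if c.testBit i then 1 else 0

/-- The number of words of weight `k`, and the slice over these words of the predicate
`u ⬝ᵥ digitWord n c ≠ 0`. -/
def paritySlice (n c k : ℕ) : ℕ × ℕ :=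
  ((wordsOfWeight n k).length, bitSlice (wordsOfWeight n k) fun u => u ⬝ᵥ digitWord n c != 0)

/-- One step of the recursion along Pascal's triangle that computes `paritySlice`. -/
def pascalStep (b : Bool) : ℕ × ℕ → List (ℕ × ℕ) → List (ℕ × ℕ)
  | _, [] => []
  | p, q :: qs =>
    (q.1 + p.1, q.2 + (p.2 ^^^ bif b then 2 ^ p.1 - 1 else 0) <<< q.1) :: pascalStep b q qs

/-- The values `paritySlice n c k` for `k < K`, computed recursively. -/
def parityTable (K : ℕ) : ℕ → ℕ → List (ℕ × ℕ)
  | 0, _ => (List.range K).map fun k => (bif k == 0 then 1 else 0, 0)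
  | n + 1, c => pascalStep (c.testBit 0) (0, 0) (parityTable K n (c / 2))

theorem vecCons_dotProduct_digitWord {n : ℕ} (c : ℕ) (a : ZMod 2) (u : Fin n → ZMod 2) :
    vecCons a u ⬝ᵥ digitWord (n + 1) c
      = (if c.testBit 0 then a else 0) + u ⬝ᵥ digitWord n (c / 2) := by
  simp [dotProduct, Fin.sum_univ_succ, digitWord, Nat.testBit_succ]

theorem paritySlice_succ_zero (n c : ℕ) :
    paritySlice (n + 1) c 0 = paritySlice n (c / 2) 0 := by
  simp [paritySlice, wordsOfWeight, bitSlice_map, Function.comp_def, vecCons_dotProduct_digitWord,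
    -cons_dotProduct]

theorem paritySlice_succ_succ (n c k : ℕ) :
    paritySlice (n + 1) c (k + 1) =
      ((paritySlice n (c / 2) (k + 1)).1 + (paritySlice n (c / 2) k).1,
        (paritySlice n (c / 2) (k + 1)).2 + ((paritySlice n (c / 2) k).2 ^^^
          bif c.testBit 0 then 2 ^ (paritySlice n (c / 2) k).1 - 1 else 0) <<<
            (paritySlice n (c / 2) (k + 1)).1) := by
  have h (x : ZMod 2) : (1 + x != 0) = !(x != 0) := by revert x; decide
  cases hc : c.testBit 0 <;>
    simp [paritySlice, wordsOfWeight, bitSlice_map, bitSlice_append, Function.comp_def,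
      vecCons_dotProduct_digitWord, hc, h, ← bitSlice_true, bitSlice_not _ (fun _ => _ != _),
      -Nat.testBit_zero, -cons_dotProduct]

theorem pascalStep_paritySlice (n c k m : ℕ) :
    pascalStep (c.testBit 0) (paritySlice n (c / 2) k)
        ((List.range' (k + 1) m).map (paritySlice n (c / 2)))
      = (List.range' (k + 1) m).map (paritySlice (n + 1) c) := by
  induction m generalizing k with
  | zero => rfl
  | succ m ih => simp [List.range'_succ, pascalStep, ih, paritySlice_succ_succ, -Nat.testBit_zero]

theorem parityTable_eq (K n c : ℕ) : parityTable K n c = (List.range K).map (paritySlice n c) := by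
  induction n generalizing c with
  | zero =>
    refine List.map_congr_left fun k _ => ?_
    cases k <;> simp [paritySlice, wordsOfWeight]
  | succ n ih =>
    rw [parityTable, ih, List.range_eq_range']
    cases K with
    | zero => rfl
    | succ K =>
      rw [List.range'_succ, List.map_cons, List.map_cons, pascalStep, pascalStep_paritySlice,
        paritySlice_succ_zero]
      simp

/-- The digit slices over the words of weight `k` of the number of nonzero products with
the words given by `cs`, read off from their parity tables. -/
def weightSlices (cs : List (List (ℕ × ℕ))) (k : ℕ) : List ℕ :=
  cs.foldr (fun c ps => addSlice ps (c.getD k (0, 0)).2) []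

theorem isDigitSlices_weightSlices (K n k : ℕ) (hk : k < K) (cs : List ℕ) :
    IsDigitSlices (wordsOfWeight n k) (weightSlices (cs.map (parityTable K n)) k)
      fun u => (cs.map fun c => (u ⬝ᵥ digitWord n c != 0).toNat).sum := by
  induction cs with
  | nil => exact fun _ => rfl
  | cons c cs ih =>
    have hc : ((parityTable K n c).getD k (0, 0)).2
        = bitSlice (wordsOfWeight n k) fun u => u ⬝ᵥ digitWord n c != 0 := by
      simp [parityTable_eq, hk, paritySlice]
    have := ih.addSlice fun u => u ⬝ᵥ digitWord n c != 0
    simp only [weightSlices, List.map_cons, List.foldr_cons, hc, List.sum_cons] at this ⊢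
    simpa only [add_comm] using this

/-- The binary matrix whose columns are given by the binary digits of `cols`. -/
def digitMatrix {n : ℕ} (cols : Fin n → ℕ) : Matrix (Fin n) (Fin n) (ZMod 2) :=
  Matrix.of fun i j => digitWord n (cols j) i

/-- The number of words `u` of weight `k` such that `u ᵥ* A` has weight `l`. -/
def weightPairCount {n : ℕ} (A : Matrix (Fin n) (Fin n) (ZMod 2)) (k l : ℕ) : ℕ :=
  (Finset.univ.filter fun u : Fin n → ZMod 2 =>
    hammingNorm u = k ∧ hammingNorm (u ᵥ* A) = l).card

/-- The values `weightPairCount (digitMatrix cols) k l` for `l ∈ ls`, computed with slices. -/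
def slicedWeightPairCounts (K d : ℕ) {n : ℕ} (cols : Fin n → ℕ) (k : ℕ) (ls : List ℕ) : List ℕ :=
  let ps := weightSlices ((List.ofFn cols).map (parityTable K n)) k
  let full := 2 ^ ((parityTable K n 0).getD k (0, 0)).1 - 1
  ls.map fun l => bitCount d (eqSlice full ps l)

theorem length_wordsOfWeight (n k : ℕ) : (wordsOfWeight n k).length = n.choose k := by
  induction n generalizing k with
  | zero => cases k <;> simp [wordsOfWeight]
  | succ n ih =>
    cases k with
    | zero => simp [wordsOfWeight, ih]
    | succ k => simp [wordsOfWeight, ih, Nat.choose_succ_succ, add_comm]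

theorem weightPairCount_eq_countP {n : ℕ} (A : Matrix (Fin n) (Fin n) (ZMod 2)) (k l : ℕ) :
    weightPairCount A k l
      = (wordsOfWeight n k).countP fun u => decide (hammingNorm (u ᵥ* A) = l) := by
  rw [List.countP_eq_length_filter,
    ← List.toFinset_card_of_nodup ((nodup_wordsOfWeight n k).filter _), weightPairCount]
  congr 1
  ext u
  simp [mem_wordsOfWeight]

theorem hammingNorm_vecMul_digitMatrix {n : ℕ} (cols : Fin n → ℕ) (u : Fin n → ZMod 2) :
    hammingNorm (u ᵥ* digitMatrix cols)
      = ((List.ofFn cols).map fun c => (u ⬝ᵥ digitWord n c != 0).toNat).sum := by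
  rw [List.map_ofFn, List.sum_ofFn, hammingNorm, Finset.card_filter]
  refine Finset.sum_congr rfl fun j _ => ?_
  change (if u ⬝ᵥ digitWord n (cols j) ≠ 0 then 1 else 0) = _
  by_cases h : u ⬝ᵥ digitWord n (cols j) = 0 <;> simp [h, bne, beq_false_of_ne]

theorem slicedWeightPairCounts_eq {K d n k : ℕ} (cols : Fin n → ℕ) (hk : k < K)
    (hd : n.choose k ≤ 2 ^ d) (ls : List ℕ) :
    slicedWeightPairCounts K d cols k ls = ls.map (weightPairCount (digitMatrix cols) k) := by
  refine List.map_congr_left fun l _ => ?_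
  have hlen : ((parityTable K n 0).getD k (0, 0)).1 = (wordsOfWeight n k).length := by
    simp [parityTable_eq, hk, paritySlice]
  rw [hlen, (isDigitSlices_weightSlices K n k hk _).eqSlice,
    bitCount_bitSlice _ _ _ ((length_wordsOfWeight n k).trans_le hd), weightPairCount_eq_countP]
  simp only [hammingNorm_vecMul_digitMatrix]

/-! ### The code generated by `(1 | A)` -/

section Code

variable {n : ℕ} {ι : Type*} (e : Fin n ⊕ Fin n ≃ ι)
  (A : Matrix (Fin n) (Fin n) (ZMod 2))

/-- The encoder `u ↦ (u, u ᵥ* A)`, with coordinates indexed along `e`. -/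
def systematicEncoder : (Fin n → ZMod 2) →ₗ[ZMod 2] (ι → ZMod 2) where
  toFun u := Sum.elim u (u ᵥ* A) ∘ e.symm
  map_add' u v := by
    funext i
    rcases h : e.symm i with j | j <;> simp [h, add_vecMul]
  map_smul' c u := by
    funext i
    rcases h : e.symm i with j | j <;> simp [h, smul_vecMul]

/-- The code generated by the rows of `(1 | A)`. -/
def systematicCode : Submodule (ZMod 2) (ι → ZMod 2) := LinearMap.range (systematicEncoder e A)

@[simp] theorem systematicEncoder_inl (u : Fin n → ZMod 2) (i : Fin n) :
    systematicEncoder e A u (e (.inl i)) = u i := by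
  simp [systematicEncoder]

@[simp] theorem systematicEncoder_inr (u : Fin n → ZMod 2) (i : Fin n) :
    systematicEncoder e A u (e (.inr i)) = (u ᵥ* A) i := by
  simp [systematicEncoder]

theorem systematicEncoder_injective : Function.Injective (systematicEncoder e A) := by
  intro u v h
  funext i
  simpa using congrFun h (e (.inl i))

theorem finrank_systematicCode : Module.finrank (ZMod 2) (systematicCode e A) = n := by
  rw [systematicCode, LinearMap.finrank_range_of_inj (systematicEncoder_injective e A),
    Module.finrank_fin_fun]

variable [Fintype ι]

theorem sum_systematicEncoder_mul (u : Fin n → ZMod 2) (w : ι → ZMod 2) :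
    ∑ i, systematicEncoder e A u i * w i
      = u ⬝ᵥ ((fun i => w (e (.inl i))) + A *ᵥ fun i => w (e (.inr i))) := by
  rw [← e.sum_comp, Fintype.sum_sum_type, dotProduct_add, dotProduct_mulVec]
  simp [dotProduct]

variable {A} in
theorem systematicCode_eq_dualCode (hA : A * Aᵀ = 1) :
    systematicCode e A = dualCode (systematicCode e A) := by
  have add_self (x : Fin n → ZMod 2) : x + x = 0 := by
    funext i; exact CharTwo.add_self_eq_zero _
  have hA' : Aᵀ * A = 1 := mul_eq_one_comm.1 hA
  ext w
  constructor
  · rintro ⟨v, rfl⟩ _ ⟨u, rfl⟩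
    rw [sum_systematicEncoder_mul]
    simp [← mulVec_transpose A, hA, add_self]
  · intro hw
    set x : Fin n → ZMod 2 := fun i => w (e (.inl i))
    set y : Fin n → ZMod 2 := fun i => w (e (.inr i))
    have hxy : x + A *ᵥ y = 0 := dotProduct_eq_zero _ fun u => by
      rw [dotProduct_comm, ← sum_systematicEncoder_mul e A u w]
      exact hw _ ⟨u, rfl⟩
    have hx : x = A *ᵥ y := by
      rw [← add_zero x, ← add_self (A *ᵥ y), ← add_assoc, hxy, zero_add]
    refine ⟨x, funext fun i => ?_⟩
    obtain ⟨j | j, rfl⟩ := e.surjective i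
    · simp [x]
    · rw [systematicEncoder_inr, hx, ← mulVec_transpose, mulVec_mulVec, hA', one_mulVec]

theorem hammingNorm_systematicEncoder (u : Fin n → ZMod 2) :
    hammingNorm (systematicEncoder e A u) = hammingNorm u + hammingNorm (u ᵥ* A) := by
  simp only [hammingNorm, Finset.card_filter]
  rw [← e.sum_comp, Fintype.sum_sum_type]
  simp

theorem ncard_systematicCode_hammingNorm_eq (w : ℕ) :
    {v | v ∈ systematicCode e A ∧ hammingNorm v = w}.ncard
      = ∑ p ∈ Finset.HasAntidiagonal.antidiagonal w, weightPairCount A p.1 p.2 := by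
  have himage : {v | v ∈ systematicCode e A ∧ hammingNorm v = w}
      = systematicEncoder e A '' ↑(Finset.univ.filter fun u : Fin n → ZMod 2 =>
          hammingNorm u + hammingNorm (u ᵥ* A) = w) := by
    ext v
    constructor
    · rintro ⟨⟨u, rfl⟩, h⟩
      exact ⟨u, by simpa [hammingNorm_systematicEncoder] using h, rfl⟩
    · rintro ⟨u, h, rfl⟩
      exact ⟨⟨u, rfl⟩, by simpa [hammingNorm_systematicEncoder] using h⟩
  rw [himage, Set.ncard_image_of_injective _ (systematicEncoder_injective e A),
    Set.ncard_coe_finset, Finset.card_eq_sum_card_fiberwise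
      (f := fun u => (hammingNorm u, hammingNorm (u ᵥ* A))) (t := Finset.HasAntidiagonal.antidiagonal w)
      (fun u hu => by simpa using hu)]
  refine Finset.sum_congr rfl fun p hp => ?_
  rw [weightPairCount, Finset.filter_filter]
  congr 1
  ext u
  simp only [Finset.mem_filter, Finset.mem_univ, true_and, Prod.ext_iff]
  rw [Finset.HasAntidiagonal.mem_antidiagonal] at hp
  omega

variable {A} in
theorem weightPairCount_comm (hA : A * A = 1) (k l : ℕ) :
    weightPairCount A k l = weightPairCount A l k := by
  refine Finset.card_nbij' (· ᵥ* A) (· ᵥ* A) ?_ ?_ ?_ ?_ <;> intro u <;>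
    simp [hA, and_comm]

end Code

/-! ### The code of length 56 -/

/-- The binary digits of these numbers are the columns of a symmetric orthogonal matrix with four
circulant blocks of size 13, up to reversing rows, and a border of width 2. -/
def borderedColumns : Fin 28 → ℕ :=
  ![82615103, 74866079, 70991567, 102604647, 84860851, 75988953, 105103340, 119656438, 93382651,
    113800189, 124008958, 129109247, 98113151, 173131620, 153674674, 177496537, 189411564,
    195364982, 164791355, 149508637, 141867278, 171592839, 152909379, 177117985, 155671952,
    144944840, 8191, 67100672]

theorem transpose_digitMatrix_borderedColumns :
    (digitMatrix borderedColumns)ᵀ = digitMatrix borderedColumns := by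
  decide +kernel

theorem digitMatrix_borderedColumns_mul_self :
    digitMatrix borderedColumns * digitMatrix borderedColumns = 1 := by
  decide +kernel

theorem weightPairCount_borderedColumns :
    (List.range 6).map (fun k => (List.range' k (13 - 2 * k)).map
        (weightPairCount (digitMatrix borderedColumns) k)) =
      [[1, 0, 0, 0, 0, 0, 0, 0, 0, 0, 0, 0, 0],
       [0, 0, 0, 0, 0, 0, 0, 0, 0, 0, 0],
       [0, 0, 0, 0, 0, 0, 0, 0, 91],
       [0, 0, 0, 0, 0, 0, 0],
       [0, 0, 0, 0, 936],
       [52, 0, 0]] := by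
  have h : ∀ k < 6, Nat.choose 28 k ≤ 2 ^ 17 := by decide
  rw [← List.map_congr_left fun k hk => slicedWeightPairCounts_eq borderedColumns
    (K := 6) (List.mem_range.1 hk) (h k (List.mem_range.1 hk)) _]
  decide +kernel

theorem weightPairCount_borderedColumns_six_six :
    weightPairCount (digitMatrix borderedColumns) 6 6 = 2704 := by
  have h : slicedWeightPairCounts 7 19 borderedColumns 6 [6] = [2704] := by decide +kernel
  rw [slicedWeightPairCounts_eq borderedColumns (by decide) (by decide)] at h
  simpa using h

theorem weightPairCount_borderedColumns_eq_zero {k l : ℕ} (h0 : 0 < k + l) (h10 : k + l < 10) :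
    weightPairCount (digitMatrix borderedColumns) k l = 0 := by
  wlog hkl : k ≤ l generalizing k l
  · rw [weightPairCount_comm digitMatrix_borderedColumns_mul_self]
    exact this (by omega) (by omega) (by omega)
  have h := weightPairCount_borderedColumns
  simp [List.range_succ, List.range'_succ] at h
  have hk : k < 5 := by omega
  have hl : l < 10 := by omega
  interval_cases k <;> interval_cases l <;> omega

theorem sum_antidiagonal_of_comm_of_table {F : ℕ → ℕ → ℕ} (hcomm : ∀ k l, F k l = F l k)
    (htable : (List.range 6).map (fun k => (List.range' k (13 - 2 * k)).map (F k)) =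
      [[1, 0, 0, 0, 0, 0, 0, 0, 0, 0, 0, 0, 0],
       [0, 0, 0, 0, 0, 0, 0, 0, 0, 0, 0],
       [0, 0, 0, 0, 0, 0, 0, 0, 91],
       [0, 0, 0, 0, 0, 0, 0],
       [0, 0, 0, 0, 936],
       [52, 0, 0]])
    (h66 : F 6 6 = 2704) :
    ∑ p ∈ Finset.HasAntidiagonal.antidiagonal 10, F p.1 p.2 = 52 ∧
      ∑ p ∈ Finset.HasAntidiagonal.antidiagonal 12, F p.1 p.2 = 4758 := by
  simp only [List.range_succ, List.range_zero, List.nil_append, List.cons_append, List.map_cons,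
    List.map_nil, List.range', List.cons.injEq, and_true, Nat.reduceMul, Nat.reduceSub,
    Nat.reduceAdd] at htable
  simp [Finset.Nat.sum_antidiagonal_eq_sum_range_succ F, Finset.sum_range_succ, htable, h66,
    hcomm 12, hcomm 11, hcomm 10, hcomm 9, hcomm 8, hcomm 7, hcomm 6 4]

theorem stmt12 : ∃ C : Submodule (ZMod 2) (Fin 56 → ZMod 2),
    C = dualCode C ∧
    Module.finrank (ZMod 2) C = 28 ∧
    (∀ v ∈ C, v ≠ 0 → 10 ≤ hammingNorm v) ∧
    (∃ v ∈ C, hammingNorm v = 10) ∧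
    {v : Fin 56 → ZMod 2 | v ∈ C ∧ hammingNorm v = 10}.ncard = 52 ∧
    {v : Fin 56 → ZMod 2 | v ∈ C ∧ hammingNorm v = 12}.ncard = 4758 := by
  let e : Fin 28 ⊕ Fin 28 ≃ Fin 56 := finSumFinEquiv
  obtain ⟨h10, h12⟩ := sum_antidiagonal_of_comm_of_table
    (weightPairCount_comm digitMatrix_borderedColumns_mul_self)
    weightPairCount_borderedColumns weightPairCount_borderedColumns_six_six
  rw [← ncard_systematicCode_hammingNorm_eq e] at h10 h12
  refine ⟨systematicCode e (digitMatrix borderedColumns), systematicCode_eq_dualCode e ?_,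
    finrank_systematicCode e _, ?_, ?_, h10, h12⟩
  · rw [transpose_digitMatrix_borderedColumns, digitMatrix_borderedColumns_mul_self]
  · rintro _ ⟨u, rfl⟩ hu
    by_contra! hlt
    have hpos := hammingNorm_pos_iff.2 hu
    rw [hammingNorm_systematicEncoder] at hlt hpos
    have := weightPairCount_borderedColumns_eq_zero hpos hlt
    rw [weightPairCount, Finset.card_eq_zero, Finset.filter_eq_empty_iff] at this
    exact this (Finset.mem_univ u) ⟨rfl, rfl⟩
  · obtain ⟨v, hv⟩ := Set.nonempty_of_ncard_ne_zero (h10.trans_ne (by decide))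
    exact ⟨v, hv.1, hv.2⟩
end

section
/- There exists a binary self-dual code C ⊆ (ZMod 2)^{68} of dimension 34 whose minimum nonzero Hamming weight is 12, such that the number of codewords of Hamming weight 12 is 1246 and the number of codewords of Hamming weight 14 is 12072 (i.e. C is an extremal self-dual [68,34,12] code with weight enumerator W_{68,2} for γ = 5, β = 201). -/
namespace LanePacking

/-- The number whose `n` base-`2 ^ w` digits are all `1`. -/
def ones (w n : ℕ) : ℕ := (2 ^ (w * n) - 1) / (2 ^ w - 1)

/-- `a` stores the list `l` of `w`-bit numbers as its length and the number with digits `l`. -/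
def Packs (w : ℕ) (a : ℕ × ℕ) (l : List ℕ) : Prop :=
  a.1 = l.length ∧ a.2 = Nat.ofDigits (2 ^ w) l ∧ ∀ x ∈ l, x < 2 ^ w

def packedAppend (w : ℕ) (a b : ℕ × ℕ) : ℕ × ℕ := (a.1 + b.1, a.2 + b.2 <<< (w * a.1))

def packedXor (w r : ℕ) (a : ℕ × ℕ) : ℕ × ℕ := (a.1, (r * ones w a.1) ^^^ a.2)

/-- The sum of the `c` lowest bits of `x`; if `o = ones w n`, this is done in each lane of `x`. -/
def bitSum (o x : ℕ) : ℕ → ℕ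
  | 0 => 0
  | c + 1 => bitSum o x c + ((x >>> c) &&& o)

/-- The indicator of `p = t` for `p, t < 64`; if `o = ones w n`, this is done in each lane of `p`. -/
def eqFlag (o t p : ℕ) : ℕ := (((((63 ^^^ t) * o) ^^^ p) + o) >>> 6) &&& o

theorem ones_eq_ofDigits {w : ℕ} (hw : 0 < w) (n : ℕ) :
    ones w n = Nat.ofDigits (2 ^ w) (List.replicate n 1) := by
  have h2 : 2 ≤ 2 ^ w := by
    calc 2 = 2 ^ 1 := rfl
      _ ≤ 2 ^ w := Nat.pow_le_pow_right (by norm_num) hw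
  rw [ones, pow_mul, ← Nat.geomSum_eq h2]
  induction n with
  | zero => simp
  | succ n ih =>
    rw [Finset.sum_range_succ', List.replicate_succ, Nat.ofDigits_cons, ← ih, Finset.mul_sum]
    simp [pow_succ', add_comm]

theorem mul_ofDigits_replicate (b r n : ℕ) :
    r * Nat.ofDigits b (List.replicate n 1) = Nat.ofDigits b (List.replicate n r) := by
  induction n with
  | zero => simp
  | succ n ih =>
    simp only [List.replicate_succ, Nat.ofDigits_cons, ← ih]
    ring

theorem ofDigits_map_add (b : ℕ) (f g : ℕ → ℕ) (l : List ℕ) :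
    Nat.ofDigits b (l.map f) + Nat.ofDigits b (l.map g) =
      Nat.ofDigits b (l.map fun x => f x + g x) := by
  induction l with
  | nil => simp
  | cons a l ih =>
    simp only [List.map_cons, Nat.ofDigits_cons, ← ih]
    ring

theorem replicate_xor_ofDigits {w r : ℕ} (hr : r < 2 ^ w) {l : List ℕ}
    (hl : ∀ x ∈ l, x < 2 ^ w) :
    Nat.ofDigits (2 ^ w) (List.replicate l.length r) ^^^ Nat.ofDigits (2 ^ w) l =
      Nat.ofDigits (2 ^ w) (l.map (r ^^^ ·)) := by
  induction l with
  | nil => simp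
  | cons a l ih =>
    have ha : a < 2 ^ w := hl a (by simp)
    have hra : r ^^^ a < 2 ^ w := Nat.xor_lt_two_pow hr ha
    simp only [List.length_cons, List.replicate_succ, List.map_cons, Nat.ofDigits_cons,
      ← ih fun x hx => hl x (by simp [hx]), add_comm _ (2 ^ w * _)]
    refine Nat.eq_of_testBit_eq fun j => ?_
    simp only [Nat.testBit_xor, Nat.testBit_two_pow_mul_add _ hr, Nat.testBit_two_pow_mul_add _ ha,
      Nat.testBit_two_pow_mul_add _ hra]
    split <;> rfl

theorem ofDigits_shiftRight_and_ones {w c : ℕ} (hc : c < w) {l : List ℕ}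
    (hl : ∀ x ∈ l, x < 2 ^ w) :
    Nat.ofDigits (2 ^ w) l >>> c &&& Nat.ofDigits (2 ^ w) (List.replicate l.length 1) =
      Nat.ofDigits (2 ^ w) (l.map fun a => a >>> c &&& 1) := by
  induction l with
  | nil => simp
  | cons a l ih =>
    have ha : a < 2 ^ w := hl a (by simp)
    have h1 : 1 < 2 ^ w := Nat.one_lt_two_pow (by omega)
    have ha1 : a >>> c &&& 1 < 2 ^ w := lt_of_le_of_lt Nat.and_le_right h1
    simp only [List.length_cons, List.replicate_succ, List.map_cons, Nat.ofDigits_cons,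
      ← ih fun x hx => hl x (by simp [hx]), add_comm _ (2 ^ w * _)]
    refine Nat.eq_of_testBit_eq fun j => ?_
    simp only [Nat.testBit_and, Nat.testBit_shiftRight, Nat.testBit_two_pow_mul_add _ h1,
      Nat.testBit_two_pow_mul_add _ ha, Nat.testBit_two_pow_mul_add _ ha1]
    by_cases hj : j < w
    · rcases Nat.eq_zero_or_pos j with rfl | h0
      · simp [hc, hj]
      · have : Nat.testBit 1 j = false := by
          rw [← Bool.not_eq_true, Nat.testBit_one_eq_true_iff_self_eq_zero]
          omega
        simp [hj, this]
    · have h : ¬ c + j < w := by omega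
      simp [hj, h, Nat.add_sub_assoc (not_lt.mp hj)]

theorem bitSum_ofDigits {w n : ℕ} (hn : n ≤ w) {l : List ℕ} (hl : ∀ x ∈ l, x < 2 ^ w) :
    bitSum (Nat.ofDigits (2 ^ w) (List.replicate l.length 1)) (Nat.ofDigits (2 ^ w) l) n =
      Nat.ofDigits (2 ^ w) (l.map fun a => bitSum 1 a n) := by
  induction n with
  | zero =>
    simp only [bitSum]
    induction l with
    | nil => simp
    | cons a l ih => simp [Nat.ofDigits_cons]
  | succ n ih =>
    simp only [bitSum, ih (by omega), ofDigits_shiftRight_and_ones (by omega : n < w) hl,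
      ofDigits_map_add]

theorem bitSum_le (x n : ℕ) : bitSum 1 x n ≤ n := by
  induction n with
  | zero => simp [bitSum]
  | succ n ih => exact Nat.add_le_add ih Nat.and_le_right

theorem eqFlag_one {p t : ℕ} (hp : p < 64) (ht : t < 64) :
    eqFlag 1 t p = if p = t then 1 else 0 := by
  have : ∀ p < 64, ∀ t < 64, eqFlag 1 t p = if p = t then 1 else 0 := by decide +kernel
  exact this p hp t ht

theorem eqFlag_ofDigits {w t : ℕ} (hw : 6 < w) (ht : t < 64) {l : List ℕ}
    (hl : ∀ x ∈ l, x < 64) :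
    eqFlag (Nat.ofDigits (2 ^ w) (List.replicate l.length 1)) t (Nat.ofDigits (2 ^ w) l) =
      Nat.ofDigits (2 ^ w) (l.map fun p => if p = t then 1 else 0) := by
  have h64 : 64 < 2 ^ w := by
    calc 64 < 2 ^ 7 := by norm_num
      _ ≤ 2 ^ w := Nat.pow_le_pow_right (by norm_num) hw
  have hx {x : ℕ} (hx : x < 64) : 63 ^^^ t ^^^ x < 64 :=
    Nat.xor_lt_two_pow (n := 6) (Nat.xor_lt_two_pow (n := 6) (by norm_num) ht) hx
  have hone : Nat.ofDigits (2 ^ w) (List.replicate l.length 1) =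
      Nat.ofDigits (2 ^ w) (l.map fun _ => 1) := by simp
  have hmap := ofDigits_shiftRight_and_ones (c := 6) hw
    (l := l.map fun x => (63 ^^^ t ^^^ x) + 1) (by
      simp only [List.mem_map, forall_exists_index, and_imp]
      rintro _ x hxl rfl
      have := hx (hl x hxl)
      omega)
  rw [List.length_map, List.map_map] at hmap
  rw [eqFlag, mul_ofDigits_replicate, replicate_xor_ofDigits
    ((Nat.xor_lt_two_pow (n := 6) (by norm_num) ht).trans h64) fun x hx => (hl x hx).trans h64]
  nth_rw 1 [hone]
  rw [ofDigits_map_add, hmap]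
  congr 1
  refine List.map_congr_left fun p hp => ?_
  rw [← eqFlag_one (hl p hp) ht]
  simp [eqFlag]

theorem ofDigits_mod_eq_sum {b : ℕ} {l : List ℕ} (h : l.sum < b - 1) :
    Nat.ofDigits b l % (b - 1) = l.sum := by
  have := Nat.ofDigits_modEq' b 1 (b - 1) (by
    have := Nat.add_mod_left (b - 1) 1
    rwa [Nat.sub_add_cancel (by omega)] at this) l
  rw [Nat.ofDigits_one, Nat.ModEq] at this
  rw [this, Nat.mod_eq_of_lt h]

/-- The bitwise sums of the `i`-element sublists of a list. -/
def xorSums : List ℕ → ℕ → List ℕ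
  | _, 0 => [0]
  | [], _ + 1 => []
  | r :: rs, i + 1 => xorSums rs (i + 1) ++ (xorSums rs i).map (r ^^^ ·)

def packedXorSums (w : ℕ) : List ℕ → ℕ → ℕ × ℕ
  | _, 0 => (1, 0)
  | [], _ + 1 => (0, 0)
  | r :: rs, i + 1 =>
    packedAppend w (packedXorSums w rs (i + 1)) (packedXor w r (packedXorSums w rs i))

/-- For each `t ∈ ts`, the number of lanes of `a` whose `n` lowest bits have sum `t`. -/
def packedHist (w n : ℕ) (ts : List ℕ) (a : ℕ × ℕ) : List ℕ :=
  ts.map fun t => eqFlag (ones w a.1) t (bitSum (ones w a.1) a.2 n) % (2 ^ w - 1)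

/-- For each `t ∈ ts`, the number of `(e + m)`-element sublists of `rs` whose bitwise sum with `c`
has exactly `t` ones among its `n` lowest bits. The sublists are run through one by one in their
first `e` elements and in parallel in the other `m`. -/
def xorHist (w n : ℕ) (ts : List ℕ) (m : ℕ) : ℕ → List ℕ → ℕ → List ℕ
  | 0, rs, c => packedHist w n ts (packedXor w c (packedXorSums w rs m))
  | _ + 1, [], _ => ts.map fun _ => 0
  | e + 1, r :: rs, c =>
    List.zipWith (· + ·) (xorHist w n ts m (e + 1) rs c) (xorHist w n ts m e rs (r ^^^ c))

theorem Packs.append {w : ℕ} {a b : ℕ × ℕ} {l k : List ℕ} (ha : Packs w a l) (hb : Packs w b k) :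
    Packs w (packedAppend w a b) (l ++ k) := by
  obtain ⟨ha1, ha2, ha3⟩ := ha
  obtain ⟨hb1, hb2, hb3⟩ := hb
  refine ⟨by simp [packedAppend, ha1, hb1], ?_, fun x hx => ?_⟩
  · rw [packedAppend, Nat.ofDigits_append, Nat.shiftLeft_eq, ha1, ha2, hb2, ← pow_mul,
      mul_comm (Nat.ofDigits _ k)]
  · rcases List.mem_append.mp hx with h | h
    exacts [ha3 x h, hb3 x h]

theorem Packs.xor {w r : ℕ} (hw : 0 < w) (hr : r < 2 ^ w) {a : ℕ × ℕ} {l : List ℕ}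
    (ha : Packs w a l) : Packs w (packedXor w r a) (l.map (r ^^^ ·)) := by
  obtain ⟨ha1, ha2, ha3⟩ := ha
  refine ⟨by simp [packedXor, ha1], ?_, ?_⟩
  · rw [packedXor, ones_eq_ofDigits hw, mul_ofDigits_replicate, ha1, ha2,
      replicate_xor_ofDigits hr ha3]
  · simp only [List.mem_map, forall_exists_index, and_imp]
    rintro _ x hx rfl
    exact Nat.xor_lt_two_pow hr (ha3 x hx)

theorem packs_packedXorSums {w : ℕ} (hw : 0 < w) {rs : List ℕ} (hrs : ∀ r ∈ rs, r < 2 ^ w)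
    (i : ℕ) : Packs w (packedXorSums w rs i) (xorSums rs i) := by
  induction rs generalizing i with
  | nil => cases i <;> simp [packedXorSums, xorSums, Packs]
  | cons r rs ih =>
    have ih := ih fun r hr => hrs r (by simp [hr])
    cases i with
    | zero => simp [packedXorSums, xorSums, Packs]
    | succ i => exact (ih _).append ((ih _).xor hw (hrs r (by simp)))

theorem length_xorSums (rs : List ℕ) (i : ℕ) : (xorSums rs i).length = rs.length.choose i := by
  induction rs generalizing i with
  | nil => cases i <;> simp [xorSums]
  | cons r rs ih => cases i <;> simp [xorSums, ih, Nat.choose_succ_succ, add_comm]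

theorem packedHist_eq {w n : ℕ} (hw : 6 < w) (hnw : n ≤ w) (hn : n < 64) {ts : List ℕ}
    (hts : ∀ t ∈ ts, t < 64) {a : ℕ × ℕ} {l : List ℕ} (ha : Packs w a l)
    (hl : l.length < 2 ^ w - 1) :
    packedHist w n ts a = ts.map fun t => l.countP fun x => bitSum 1 x n = t := by
  obtain ⟨ha1, ha2, ha3⟩ := ha
  refine List.map_congr_left fun t ht => ?_
  have hflag := eqFlag_ofDigits hw (hts t ht) (l := l.map fun x => bitSum 1 x n) (by
    simp only [List.mem_map, forall_exists_index, and_imp]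
    rintro _ x - rfl
    exact (bitSum_le x n).trans_lt hn)
  have hsum : ((l.map fun x => bitSum 1 x n).map fun p => if p = t then 1 else 0).sum =
      l.countP fun x => bitSum 1 x n = t := by
    clear hflag hl ha1 ha2 ha3
    induction l with
    | nil => rfl
    | cons x l ih => simp [List.countP_cons, ← ih, add_comm]
  rw [List.length_map] at hflag
  rw [ones_eq_ofDigits (by omega), ha1, ha2, bitSum_ofDigits hnw ha3, hflag,
    ofDigits_mod_eq_sum, hsum]
  rw [hsum]
  exact List.countP_le_length.trans_lt hl

theorem packedHist_packedXor {w n : ℕ} (hw : 6 < w) (hnw : n ≤ w) (hn : n < 64) {ts : List ℕ}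
    (hts : ∀ t ∈ ts, t < 64) (m : ℕ) {rs : List ℕ} (hrs : ∀ r ∈ rs, r < 2 ^ w)
    (hlen : rs.length < w) {c : ℕ} (hc : c < 2 ^ w) :
    packedHist w n ts (packedXor w c (packedXorSums w rs m)) =
      ts.map fun t => (xorSums rs m).countP fun x => bitSum 1 (c ^^^ x) n = t := by
  have hcard : ((xorSums rs m).map (c ^^^ ·)).length < 2 ^ w - 1 := by
    have h1 := Nat.choose_le_two_pow rs.length m
    have h2 : 2 ^ rs.length ≤ 2 ^ (w - 1) := Nat.pow_le_pow_right (by norm_num) (by omega)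
    have h3 : 2 ^ 1 ≤ 2 ^ (w - 1) := Nat.pow_le_pow_right (by norm_num) (by omega)
    have h4 : 2 ^ w = 2 ^ (w - 1) * 2 := by rw [← pow_succ]; congr 1; omega
    rw [List.length_map, length_xorSums]
    omega
  rw [packedHist_eq hw hnw hn hts ((packs_packedXorSums (by omega) hrs m).xor (by omega) hc) hcard]
  simp only [List.countP_map, Function.comp_def]

theorem xorHist_eq {w n : ℕ} (hw : 6 < w) (hnw : n ≤ w) (hn : n < 64) {ts : List ℕ}
    (hts : ∀ t ∈ ts, t < 64) (m e : ℕ) {rs : List ℕ} (hrs : ∀ r ∈ rs, r < 2 ^ w)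
    (hlen : rs.length < w) {c : ℕ} (hc : c < 2 ^ w) :
    xorHist w n ts m e rs c =
      ts.map fun t => (xorSums rs (m + e)).countP fun x => bitSum 1 (c ^^^ x) n = t := by
  induction rs generalizing e c with
  | nil =>
    cases e with
    | zero =>
      simp only [xorHist, packedHist_packedXor hw hnw hn hts m hrs hlen hc, add_zero]
    | succ e => simp [xorHist, xorSums]
  | cons r rs ih =>
    cases e with
    | zero =>
      simp only [xorHist, packedHist_packedXor hw hnw hn hts m hrs hlen hc, add_zero]
    | succ e =>
      have hr : r < 2 ^ w := hrs r (by simp)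
      have hrs' : ∀ r ∈ rs, r < 2 ^ w := fun r hr => hrs r (by simp [hr])
      have hlen' : rs.length < w := by simp at hlen; omega
      rw [xorHist, ih (e + 1) hrs' hlen' hc, ih e hrs' hlen' (Nat.xor_lt_two_pow hr hc),
        List.zipWith_map, List.zipWith_self]
      refine List.map_congr_left fun t _ => ?_
      rw [← Nat.add_assoc]
      simp only [xorSums, List.countP_append, List.countP_map, Function.comp_def,
        ← Nat.xor_assoc, Nat.xor_comm r c]

section XorSum

/-- The bitwise sum of the numbers `f i` over all `i` with `x i ≠ 0`. -/
def xorSum : {n : ℕ} → (Fin n → ℕ) → (Fin n → ZMod 2) → ℕ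
  | 0, _, _ => 0
  | _ + 1, f, x => (if x 0 = 0 then 0 else f 0) ^^^ xorSum (Fin.tail f) (Fin.tail x)

/-- The matrix whose `i`-th row consists of the binary digits of `f i`. -/
def bitMatrix {m : ℕ} (n : ℕ) (f : Fin m → ℕ) : Matrix (Fin m) (Fin n) (ZMod 2) :=
  Matrix.of fun i j => if (f i).testBit j then 1 else 0

theorem hammingNorm_cons {R : Type*} [Zero R] [DecidableEq R] {n : ℕ} (a : R) (x : Fin n → R) :
    hammingNorm (Fin.cons a x : Fin (n + 1) → R) = (if a = 0 then 0 else 1) + hammingNorm x := by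
  simp only [hammingNorm, Finset.card_filter, Fin.sum_univ_succ, Fin.cons_zero, Fin.cons_succ]
  split_ifs <;> simp_all

theorem xorSums_zero (l : List ℕ) : xorSums l 0 = [0] := by cases l <;> rfl

theorem sum_univ_cons_zmod_two {M : Type*} [AddCommMonoid M] {n : ℕ}
    (g : (Fin (n + 1) → ZMod 2) → M) :
    ∑ x, g x = (∑ x, g (Fin.cons 0 x)) + ∑ x, g (Fin.cons 1 x) := by
  rw [← (Fin.consEquiv fun _ => ZMod 2).sum_comp, Fintype.sum_prod_type]
  exact Fin.sum_univ_two _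

theorem card_filter_xorSum {n : ℕ} (f : Fin n → ℕ) (i : ℕ) (p : ℕ → Bool) :
    (Finset.univ.filter fun x : Fin n → ZMod 2 => hammingNorm x = i ∧ p (xorSum f x)).card =
      (xorSums (List.ofFn f) i).countP p := by
  induction n generalizing i p with
  | zero =>
    cases i with
    | zero => cases h : p 0 <;> simp [xorSums_zero, xorSum, hammingNorm, h]
    | succ i => simp [xorSums, hammingNorm]
  | succ n ih =>
    have key : (Finset.univ.filter fun x : Fin (n + 1) → ZMod 2 =>
        hammingNorm x = i ∧ p (xorSum f x)).card =
        (Finset.univ.filter fun x : Fin n → ZMod 2 =>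
          hammingNorm x = i ∧ p (xorSum (Fin.tail f) x)).card +
        (Finset.univ.filter fun x : Fin n → ZMod 2 =>
          1 + hammingNorm x = i ∧ p (f 0 ^^^ xorSum (Fin.tail f) x)).card := by
      simp only [Finset.card_filter, sum_univ_cons_zmod_two]
      simp [hammingNorm_cons, xorSum]
    rw [key, ih, List.ofFn_succ]
    cases i with
    | zero => simp [xorSums_zero]
    | succ i =>
      have := ih (Fin.tail f) i (fun y => p (f 0 ^^^ y))
      simp only [add_comm 1, add_left_inj]
      rw [this, xorSums, List.countP_append, List.countP_map]
      rfl

theorem xorSum_testBit {n : ℕ} (f : Fin n → ℕ) (x : Fin n → ZMod 2) (j : ℕ) :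
    (if (xorSum f x).testBit j then 1 else 0 : ZMod 2) =
      ∑ i, x i * if (f i).testBit j then 1 else 0 := by
  induction n with
  | zero => simp [xorSum]
  | succ n ih =>
    have hx : x 0 = 0 ∨ x 0 = 1 := by generalize x 0 = a; revert a; decide
    have ih : _ = ∑ i : Fin n, x i.succ * if (f i.succ).testBit j then 1 else 0 :=
      ih (Fin.tail f) (Fin.tail x)
    rw [Fin.sum_univ_succ, ← ih, xorSum, Nat.testBit_xor]
    rcases hx with h | h
    · simp [h]
    · cases hf : (f 0).testBit j <;> cases hg : (xorSum (Fin.tail f) (Fin.tail x)).testBit j <;>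
        simp [h, hf]
      rfl

theorem bitSum_one_eq_sum (y n : ℕ) :
    bitSum 1 y n = ∑ j : Fin n, if y.testBit j then 1 else 0 := by
  induction n with
  | zero => rfl
  | succ n ih =>
    rw [Fin.sum_univ_castSucc, bitSum, ih]
    congr 1
    simp only [Nat.testBit, Nat.and_comm 1, Nat.and_one_is_mod, Fin.val_last, bne_iff_ne]
    split_ifs <;> omega

theorem hammingNorm_vecMul_bitMatrix {m n : ℕ} (f : Fin m → ℕ) (x : Fin m → ZMod 2) :
    hammingNorm (Matrix.vecMul x (bitMatrix n f)) = bitSum 1 (xorSum f x) n := by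
  have h (j : Fin n) : Matrix.vecMul x (bitMatrix n f) j =
      if (xorSum f x).testBit j then 1 else 0 := by
    rw [xorSum_testBit]
    rfl
  simp [hammingNorm, h, bitSum_one_eq_sum]

end XorSum

/-- The number of vectors `x` of weight `i` such that `x A` has weight `j`. -/
def weightCount {R : Type*} [CommRing R] [Fintype R] [DecidableEq R] {n : ℕ}
    (A : Matrix (Fin n) (Fin n) R) (i j : ℕ) : ℕ :=
  (Finset.univ.filter fun x => hammingNorm x = i ∧ hammingNorm (Matrix.vecMul x A) = j).card

theorem xorHist_ofFn {w n : ℕ} (hw : 6 < w) (hnw : n < w) (hn : n < 64) {ts : List ℕ}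
    (hts : ∀ t ∈ ts, t < 64) (m e : ℕ) {f : Fin n → ℕ} (hf : ∀ i, f i < 2 ^ w) :
    xorHist w n ts m e (List.ofFn f) 0 = ts.map (weightCount (bitMatrix n f) (m + e)) := by
  rw [xorHist_eq hw hnw.le hn hts m e (by simpa [List.mem_ofFn] using hf) (by simpa) (by simp)]
  refine List.map_congr_left fun t _ => ?_
  rw [← card_filter_xorSum]
  simp [weightCount, hammingNorm_vecMul_bitMatrix]

end LanePacking

namespace SystematicCode

open LanePacking

variable {R : Type*} [CommRing R] {n : ℕ}

/-- The encoder `x ↦ (x, x A)`. -/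
def encode (A : Matrix (Fin n) (Fin n) R) : (Fin n → R) →ₗ[R] (Fin (n + n) → R) where
  toFun x := Fin.append x (Matrix.vecMul x A)
  map_add' x y := by
    ext i
    refine Fin.addCases (fun i => ?_) (fun i => ?_) i <;>
      simp [-Fin.natAdd_eq_addNat, Matrix.add_vecMul]
  map_smul' c x := by
    ext i
    refine Fin.addCases (fun i => ?_) (fun i => ?_) i <;>
      simp [-Fin.natAdd_eq_addNat, Matrix.smul_vecMul]

theorem encode_apply (A : Matrix (Fin n) (Fin n) R) (x : Fin n → R) :
    encode A x = Fin.append x (Matrix.vecMul x A) := rfl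

theorem encode_injective (A : Matrix (Fin n) (Fin n) R) : Function.Injective (encode A) := by
  intro x y h
  ext i
  simpa [encode_apply] using congrFun h (Fin.castAdd n i)

theorem sum_append_mul_append (x y u v : Fin n → R) :
    ∑ i, Fin.append x y i * Fin.append u v i = x ⬝ᵥ u + y ⬝ᵥ v := by
  simp [-Fin.natAdd_eq_addNat, Fin.sum_univ_add, dotProduct]

theorem range_encode_eq_dualCode {A : Matrix (Fin n) (Fin n) R} (hA : A * A.transpose = -1) :
    LinearMap.range (encode A) = dualCode (LinearMap.range (encode A)) := by
  have hA' : A.transpose * A = -1 := by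
    have h : A * -A.transpose = 1 := by simp [hA]
    rw [mul_eq_one_comm] at h
    simpa using congrArg (- ·) h
  ext w
  constructor
  · rintro ⟨y, rfl⟩ _ ⟨x, rfl⟩
    rw [encode_apply, encode_apply, sum_append_mul_append, ← Matrix.mulVec_transpose A y,
      ← Matrix.dotProduct_mulVec, Matrix.mulVec_mulVec, hA]
    simp [Matrix.neg_mulVec]
  · intro hw
    obtain ⟨u, v, rfl⟩ : ∃ u v, w = Fin.append u v :=
      ⟨_, _, (Fin.append_castAdd_natAdd (f := w)).symm⟩
    have huv : u + Matrix.mulVec A v = 0 := dotProduct_eq_zero _ fun x => by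
      have := hw _ ⟨x, rfl⟩
      rw [encode_apply, sum_append_mul_append, ← Matrix.dotProduct_mulVec] at this
      rw [dotProduct_comm, dotProduct_add, this]
    refine ⟨u, ?_⟩
    rw [encode_apply, eq_neg_of_add_eq_zero_left huv, ← Matrix.mulVec_transpose,
      Matrix.mulVec_neg, Matrix.mulVec_mulVec, hA']
    simp [Matrix.neg_mulVec]

theorem hammingNorm_append [DecidableEq R] (x y : Fin n → R) :
    hammingNorm (Fin.append x y) = hammingNorm x + hammingNorm y := by
  simp [-Fin.natAdd_eq_addNat, hammingNorm, Finset.card_filter, Fin.sum_univ_add]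

theorem finrank_range_encode [Nontrivial R] (A : Matrix (Fin n) (Fin n) R) :
    Module.finrank R (LinearMap.range (encode A)) = n := by
  rw [LinearMap.finrank_range_of_inj (encode_injective A), Module.finrank_fin_fun]

variable [Fintype R] [DecidableEq R]

theorem weightCount_comm {A B : Matrix (Fin n) (Fin n) R} (hAB : A * B = 1) (i j : ℕ) :
    weightCount A i j = weightCount B j i := by
  have hBA : B * A = 1 := mul_eq_one_comm.mp hAB
  refine Finset.card_bij' (fun x _ => Matrix.vecMul x A) (fun y _ => Matrix.vecMul y B)
    ?_ ?_ ?_ ?_ <;> simp +contextual [hAB, hBA]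

theorem ncard_range_encode_hammingNorm (A : Matrix (Fin n) (Fin n) R) (w : ℕ) :
    {v | v ∈ LinearMap.range (encode A) ∧ hammingNorm v = w}.ncard =
      ∑ p ∈ Finset.HasAntidiagonal.antidiagonal w, weightCount A p.1 p.2 := by
  have himage : {v | v ∈ LinearMap.range (encode A) ∧ hammingNorm v = w} = encode A ''
      (Finset.univ.filter fun x => hammingNorm x + hammingNorm (Matrix.vecMul x A) = w :
        Finset (Fin n → R)) := by
    ext v
    constructor
    · rintro ⟨⟨x, rfl⟩, h⟩
      exact ⟨x, by simpa [encode_apply, hammingNorm_append] using h, rfl⟩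
    · rintro ⟨x, h, rfl⟩
      exact ⟨⟨x, rfl⟩, by simpa [encode_apply, hammingNorm_append] using h⟩
  rw [himage, Set.ncard_image_of_injective _ (encode_injective A), Set.ncard_coe_finset,
    Finset.card_eq_sum_card_fiberwise (t := Finset.HasAntidiagonal.antidiagonal w)
      (f := fun x => (hammingNorm x, hammingNorm (Matrix.vecMul x A)))
      (by intro x hx; simpa using hx)]
  refine Finset.sum_congr rfl fun p hp => ?_
  rw [Finset.HasAntidiagonal.mem_antidiagonal] at hp
  rw [weightCount, Finset.filter_filter]
  congr 1
  ext x
  simp only [Finset.mem_filter, Finset.mem_univ, true_and, Prod.ext_iff]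
  constructor
  · exact fun h => h.2
  · exact fun h => ⟨by rw [h.1, h.2, hp], h⟩

end SystematicCode

namespace ExtremalCode68

open LanePacking SystematicCode

def generatorRows : List ℕ := [
  2785556583, 7500339151, 1671937151, 7986940111, 1542407639, 14339579599, 10027053353,
  15757915713, 471706417, 2520061889, 12336233369, 10716701994, 16114353474, 2142870578,
  8596286146, 1787975322, 1995148532, 16050425244, 5957356036, 14235347956, 9979879580,
  651569592, 16434716256, 1589032928, 5559386112, 8545190080, 4923506688, 6742032384,
  12043665152, 1779338496, 1735687680, 10367356672, 2841285632, 1453680640]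

def generatorCols : List ℕ := [
  2047, 63551, 2031679, 3312750, 3908884, 15280453, 46748351, 45860410, 2963939154,
  3503081378, 8334326454, 12623766829, 5649770215, 9944190405, 12051336208, 5197888996,
  11194679068, 5313105054, 10333590462, 5253051867, 8052847520, 11887407860, 8040045584,
  11156039796, 8040752342, 10233425591, 10043469675, 7306653082, 8772071290, 8156326023,
  12681329788, 4735506059, 256774314, 2421841120]

/-- Entry `j` of list `i` is `weightCount generator i j`. -/
def leftCounts : List (List ℕ) := [
  [1, 0, 0, 0, 0, 0, 0, 0, 0, 0, 0, 0, 0, 0, 0],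
  [0, 0, 0, 0, 0, 0, 0, 0, 0, 0, 0, 8, 0, 1],
  [0, 0, 0, 0, 0, 0, 0, 0, 0, 0, 26, 0, 11],
  [0, 0, 0, 0, 0, 0, 0, 0, 0, 76, 0, 93],
  [0, 0, 0, 0, 0, 0, 0, 0, 148, 0, 372],
  [0, 0, 0, 0, 0, 0, 0, 250, 0, 1214],
  [0, 0, 0, 0, 0, 0, 285, 0, 2423],
  [0, 0, 0, 0, 0, 232, 0, 2962]]

/-- Entry `j` of list `i` is `weightCount generator j i`. -/
def rightCounts : List (List ℕ) := [
  [1, 0, 0, 0, 0, 0, 0, 0, 0, 0, 0, 0, 0, 0, 0],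
  [0, 0, 0, 0, 0, 0, 0, 0, 0, 0, 0, 6, 0, 4],
  [0, 0, 0, 0, 0, 0, 0, 0, 0, 0, 25, 0, 33],
  [0, 0, 0, 0, 0, 0, 0, 0, 0, 60, 0, 185],
  [0, 0, 0, 0, 0, 0, 0, 0, 130, 0, 618],
  [0, 0, 0, 0, 0, 0, 0, 232, 0, 1541],
  [0, 0, 0, 0, 0, 0, 285, 0, 2615]]

def row (i : Fin 34) : ℕ := generatorRows.getD i 0

def col (i : Fin 34) : ℕ := generatorCols.getD i 0

/-- The matrix `A` such that the code with generator matrix `(1 | A)` is the one sought. -/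
def generator : Matrix (Fin 34) (Fin 34) (ZMod 2) := bitMatrix 34 row

set_option maxRecDepth 100000 in
theorem xorHist_row : ∀ i < 8,
    xorHist 35 34 (List.range (15 - i)) (min i 5) (i - 5) generatorRows 0 =
      leftCounts.getD i [] := by
  decide +kernel

set_option maxRecDepth 100000 in
theorem xorHist_col : ∀ i < 7,
    xorHist 35 34 (List.range (15 - i)) (min i 5) (i - 5) generatorCols 0 =
      rightCounts.getD i [] := by
  decide +kernel

theorem row_lt : ∀ i, row i < 2 ^ 35 := by decide +kernel

theorem col_lt : ∀ i, col i < 2 ^ 35 := by decide +kernel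

theorem generator_transpose : generator.transpose = bitMatrix 34 col := by decide +kernel

theorem generator_mul_transpose : generator * generator.transpose = 1 := by decide +kernel

theorem ofFn_row : List.ofFn row = generatorRows := by decide +kernel

theorem ofFn_col : List.ofFn col = generatorCols := by decide +kernel

theorem getD_xorHist {f : Fin 34 → ℕ} (hf : ∀ i, f i < 2 ^ 35) {i j : ℕ} (hij : i + j < 15) :
    (xorHist 35 34 (List.range (15 - i)) (min i 5) (i - 5) (List.ofFn f) 0).getD j 0 =
      weightCount (bitMatrix 34 f) i j := by
  rw [xorHist_ofFn (by norm_num) (by norm_num) (by norm_num) (by simp; omega) _ _ hf,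
    show min i 5 + (i - 5) = i by omega]
  have : j < 15 - i := by omega
  simp [this]

theorem weightCount_generator {i j : ℕ} (hij : i + j < 15) :
    weightCount generator i j =
      if i < 8 then (leftCounts.getD i []).getD j 0 else (rightCounts.getD j []).getD i 0 := by
  split_ifs with hi
  · rw [← xorHist_row i hi, ← ofFn_row, getD_xorHist row_lt hij, generator]
  · rw [weightCount_comm generator_mul_transpose, ← xorHist_col j (by omega), ← ofFn_col,
      getD_xorHist col_lt (by omega), generator_transpose]

/-- The numbers of codewords of weight at most `14`. -/
theorem ncard_hammingNorm {w : ℕ} (hw : w < 15) :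
    {v | v ∈ LinearMap.range (encode generator) ∧ hammingNorm v = w}.ncard =
      [1, 0, 0, 0, 0, 0, 0, 0, 0, 0, 0, 0, 1246, 0, 12072].getD w 0 := by
  rw [ncard_range_encode_hammingNorm]
  have hcount : ∀ w < 15, (∑ p ∈ Finset.HasAntidiagonal.antidiagonal w,
      if p.1 < 8 then (leftCounts.getD p.1 []).getD p.2 0
      else (rightCounts.getD p.2 []).getD p.1 0) =
      [1, 0, 0, 0, 0, 0, 0, 0, 0, 0, 0, 0, 1246, 0, 12072].getD w 0 := by
    decide +kernel
  rw [← hcount w hw]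
  refine Finset.sum_congr rfl fun p hp => weightCount_generator ?_
  rw [Finset.HasAntidiagonal.mem_antidiagonal] at hp
  omega

end ExtremalCode68

theorem stmt15 : ∃ C : Submodule (ZMod 2) (Fin 68 → ZMod 2),
    C = dualCode C ∧
    Module.finrank (ZMod 2) C = 34 ∧
    (∀ v ∈ C, v ≠ 0 → 12 ≤ hammingNorm v) ∧
    (∃ v ∈ C, hammingNorm v = 12) ∧
    {v : Fin 68 → ZMod 2 | v ∈ C ∧ hammingNorm v = 12}.ncard = 1246 ∧
    {v : Fin 68 → ZMod 2 | v ∈ C ∧ hammingNorm v = 14}.ncard = 12072 := by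
  have hdual := SystematicCode.range_encode_eq_dualCode
    (A := ExtremalCode68.generator) (by rw [ExtremalCode68.generator_mul_transpose, CharTwo.neg_eq])
  have hcard {w : ℕ} (hw : w < 15) := ExtremalCode68.ncard_hammingNorm hw
  refine ⟨LinearMap.range (SystematicCode.encode ExtremalCode68.generator), hdual,
    ?_, fun v hv hv0 => ?_, ?_, hcard (by norm_num),
    hcard (by norm_num)⟩
  · convert SystematicCode.finrank_range_encode ExtremalCode68.generator
  · by_contra! h
    have hzero : ∀ w < 12, 0 < w →
        [1, 0, 0, 0, 0, 0, 0, 0, 0, 0, 0, 0, 1246, 0, 12072].getD w 0 = 0 := by decide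
    have hw := hcard (h.trans (by norm_num : 12 < 15))
    rw [hzero _ h (hammingNorm_pos_iff.mpr hv0), Set.ncard_eq_zero (Set.toFinite _)] at hw
    exact (Set.eq_empty_iff_forall_notMem.mp hw v) ⟨hv, rfl⟩
  · exact Set.nonempty_of_ncard_ne_zero ((hcard (by norm_num : 12 < 15)).trans_ne (by decide))
end
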